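/- arXiv:1612.07972 — 2 statements merged into one kernel-verified Lean document; each statement's English description precedes it below -/
import Mathlib

section
/- Let α ∈ L(H,K) be a strict contraction (‖α‖ < 1). Then the Frostman transformation Φ_α(β) := D_{α*}(I - βα*)^{-1}(β - α)D_α^{-1} maps the open unit ball of L(H,K) into itself, and Φ_α^{-1}(β) := D_{α*}^{-1}(β + α)(I + α*β)^{-1}D_α is its compositional inverse: Φ_α^{-1}(Φ_α(β)) = β for every strict contraction β. -/
open ContinuousLinearMap

noncomputable section

variable {H K : Type*}
  [NormedAddCommGroup H] [InnerProductSpace ℂ H] [CompleteSpace H]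
  [NormedAddCommGroup K] [InnerProductSpace ℂ K] [CompleteSpace K]

/-- The Frostman transformation `Φ_α(β) = D_{α*} (1 - βα*)⁻¹ (β - α) D_α⁻¹`. -/
def frostman (α : H →L[ℂ] K) (Dα : H →L[ℂ] H) (Dα' : K →L[ℂ] K) (β : H →L[ℂ] K) :
    H →L[ℂ] K :=
  Dα' ∘L (Ring.inverse (1 - β ∘L adjoint α)) ∘L (β - α) ∘L (Ring.inverse Dα)

/-- The inverse Frostman transformation `Φ_α⁻¹(β) = D_{α*}⁻¹ (β + α) (1 + α*β)⁻¹ D_α`. -/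
def frostmanInv (α : H →L[ℂ] K) (Dα : H →L[ℂ] H) (Dα' : K →L[ℂ] K) (β : H →L[ℂ] K) :
    H →L[ℂ] K :=
  (Ring.inverse Dα') ∘L (β + α) ∘L (Ring.inverse (1 + (adjoint α) ∘L β)) ∘L Dα

lemma fr_adj_one {E : Type*} [NormedAddCommGroup E] [InnerProductSpace ℂ E] [CompleteSpace E] :
    adjoint (1 : E →L[ℂ] E) = 1 := by
  rw [← star_eq_adjoint, star_one]

lemma fr_isUnit {E : Type*} [NormedAddCommGroup E] [InnerProductSpace ℂ E] [CompleteSpace E]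
    (A : E →L[ℂ] E) (hA : ‖A‖ < 1) : IsUnit (1 - A) :=
  isUnit_one_sub_of_norm_lt_one hA

lemma fr_comp_lt {E F G : Type*} [NormedAddCommGroup E] [InnerProductSpace ℂ E]
    [NormedAddCommGroup F] [InnerProductSpace ℂ F]
    [NormedAddCommGroup G] [InnerProductSpace ℂ G]
    (A : F →L[ℂ] G) (B : E →L[ℂ] F) (hA : ‖A‖ < 1) (hB : ‖B‖ < 1) : ‖A ∘L B‖ < 1 := by
  refine (A.opNorm_comp_le B).trans_lt ?_
  nlinarith [norm_nonneg A, norm_nonneg B]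

lemma fr_adj_lt {E F : Type*} [NormedAddCommGroup E] [InnerProductSpace ℂ E] [CompleteSpace E]
    [NormedAddCommGroup F] [InnerProductSpace ℂ F] [CompleteSpace F]
    (A : E →L[ℂ] F) (hA : ‖A‖ < 1) : ‖adjoint A‖ < 1 := by
  rwa [LinearIsometryEquiv.norm_map]

/-- The intertwining relation for the defect operators. -/
lemma fr_intertwine (α : H →L[ℂ] K) 
    (D : H →L[ℂ] H) (hD : D.IsPositive) (hD2 : D ∘L D = 1 - (adjoint α) ∘L α)
    (D' : K →L[ℂ] K) (hD' : D'.IsPositive) (hD'2 : D' ∘L D' = 1 - α ∘L (adjoint α))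
    (hu : IsUnit D') :
    D' ∘L α = α ∘L D := by
  have hDs : adjoint D = D := hD.isSelfAdjoint.adjoint_eq
  have hDs' : adjoint D' = D' := hD'.isSelfAdjoint.adjoint_eq
  obtain ⟨T, hT⟩ : ∃ T, T = D' ∘L α - α ∘L D := ⟨_, rfl⟩
  have e1 : D' ∘L T = - (T ∘L D) := by
    ext x
    have h1 := congrArg (fun A => A (α x)) hD'2
    have h2 := congrArg (fun A => α (A x)) hD2
    simp at h1 h2
    simp [hT, h1, h2]
  have e2 : adjoint T ∘L D' = - (D ∘L adjoint T) := by
    have := congrArg adjoint e1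
    simpa [adjoint_comp, hDs, hDs'] using this
  have e3 : (adjoint T ∘L T) ∘L D = D ∘L (adjoint T ∘L T) := by
    have h1 : (adjoint T ∘L T) ∘L D = - (adjoint T ∘L (D' ∘L T)) := by
      rw [e1]; ext x; simp
    rw [h1, ← comp_assoc, e2]; ext x; simp
  have hpos : (0 : H →L[ℂ] H) ≤ (adjoint T ∘L T) * D := by
    refine Commute.mul_nonneg ?_ ?_ e3
    · rw [nonneg_iff_isPositive]; exact isPositive_adjoint_comp_self T
    · rw [nonneg_iff_isPositive]; exact hD
  rw [nonneg_iff_isPositive] at hpos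
  have e4 : (adjoint T ∘L T) * D = - (adjoint T ∘L D' ∘L T) := by
    rw [e1]; ext x; simp
  have e5 : adjoint T ∘L D' ∘L T = 0 := by
    have h1 : (0 : H →L[ℂ] H) ≤ adjoint T ∘L D' ∘L T := by
      rw [nonneg_iff_isPositive]; exact hD'.adjoint_conj T
    have h2 : (0 : H →L[ℂ] H) ≤ - (adjoint T ∘L D' ∘L T) := by
      rw [nonneg_iff_isPositive, ← e4]; exact hpos
    exact le_antisymm (neg_nonneg.mp h2) h1
  have e6 : adjoint (D' ∘L T) ∘L (D' ∘L T) = 0 := by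
    rw [adjoint_comp, hDs', e2]
    have : (-(D ∘L adjoint T)) ∘L (D' ∘L T) = - (D ∘L (adjoint T ∘L D' ∘L T)) := by
      ext x; simp
    rw [this, e5]; simp
  have e7 : D' ∘L T = 0 := by
    ext x
    have h := congrArg (fun A => inner ℂ (A x) x) e6
    simp only [comp_apply, adjoint_inner_left] at h
    simpa using h
  have e8 : T = 0 := by
    obtain ⟨u, rfl⟩ := hu
    ext x
    have h := congrArg (fun A => (↑u⁻¹ : K →L[ℂ] K) (A x)) e7
    have h2 := congrArg (fun A : K →L[ℂ] K => A (T x)) u.inv_mul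
    have h2' : (↑u⁻¹ : K →L[ℂ] K) ((u : K →L[ℂ] K) (T x)) = T x := h2
    have h' : (↑u⁻¹ : K →L[ℂ] K) ((u : K →L[ℂ] K) (T x)) = (↑u⁻¹ : K →L[ℂ] K) 0 := h
    rw [h2', map_zero] at h'
    simpa using h'
  rw [hT] at e8
  exact sub_eq_zero.mp e8

lemma fr_norm_sq {E F : Type*} [NormedAddCommGroup E] [InnerProductSpace ℂ E] [CompleteSpace E]
    [NormedAddCommGroup F] [InnerProductSpace ℂ F] [CompleteSpace F]
    (A : E →L[ℂ] F) (D : E →L[ℂ] E) (hD : adjoint D = D)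
    (h : D ∘L D = 1 - adjoint A ∘L A) (x : E) : ‖D x‖ ^ 2 = ‖x‖ ^ 2 - ‖A x‖ ^ 2 := by
  have h1 := congrArg (fun B => RCLike.re (inner ℂ (B x) x)) h
  simp only [comp_apply, sub_apply, inner_sub_left, adjoint_inner_left, map_sub,
    inner_self_eq_norm_sq] at h1
  have h2 : RCLike.re (inner ℂ ((1 : E →L[ℂ] E) x) x) = ‖x‖ ^ 2 := inner_self_eq_norm_sq (𝕜 := ℂ) x
  rw [h2] at h1
  rw [← h1, ← inner_self_eq_norm_sq (𝕜 := ℂ)]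
  nth_rewrite 3 [← hD]
  rw [adjoint_inner_left]

lemma fr_key (α : H →L[ℂ] K) 
    (D : H →L[ℂ] H) (hD : adjoint D = D) (hD2 : D ∘L D = 1 - (adjoint α) ∘L α)
    (D' : K →L[ℂ] K) (hD' : adjoint D' = D') (hD'2 : D' ∘L D' = 1 - α ∘L (adjoint α))
    (p : K) (q : H) :
    ‖p - α q‖ ^ 2 - ‖q - adjoint α p‖ ^ 2 = ‖D' p‖ ^ 2 - ‖D q‖ ^ 2 := by
  rw [fr_norm_sq α D hD hD2, fr_norm_sq (adjoint α) D' hD' (by simpa using hD'2),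
    @norm_sub_sq ℂ, @norm_sub_sq ℂ, adjoint_inner_right, inner_re_symm (𝕜 := ℂ) p]
  ring

lemma fr_bound (P : H →L[ℂ] K) (b : H →L[ℂ] K) (hb : ‖b‖ < 1) (W : H →L[ℂ] H)
    (V : H →L[ℂ] H) (hVW : V ∘L W = 1)
    (h : ∀ z, ‖V z‖ ^ 2 - ‖P (V z)‖ ^ 2 = ‖z‖ ^ 2 - ‖b z‖ ^ 2) : ‖P‖ < 1 := by
  have hM : 0 < ‖V‖ + 1 := by positivity
  have hc0 : 0 < 1 - ‖b‖ ^ 2 := by nlinarith [norm_nonneg b]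
  have hr : (1 - ‖b‖ ^ 2) / (‖V‖ + 1) ^ 2 > 0 := by positivity
  have hr1 : (1 - ‖b‖ ^ 2) / (‖V‖ + 1) ^ 2 ≤ 1 := by
    rw [div_le_one (by positivity)]
    nlinarith [norm_nonneg b, norm_nonneg V]
  have : ‖P‖ ≤ √(1 - (1 - ‖b‖ ^ 2) / (‖V‖ + 1) ^ 2) := by
    refine P.opNorm_le_bound (Real.sqrt_nonneg _) fun y => ?_
    have hy : V (W y) = y := congrArg (fun A => A y) hVW
    have h1 := h (W y)
    rw [hy] at h1
    have h2 : ‖b (W y)‖ ^ 2 ≤ ‖b‖ ^ 2 * ‖W y‖ ^ 2 := by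
      rw [← mul_pow]; gcongr; exact b.le_opNorm _
    have h3 : ‖y‖ ^ 2 ≤ (‖V‖ + 1) ^ 2 * ‖W y‖ ^ 2 := by
      rw [← mul_pow]; gcongr
      calc ‖y‖ = ‖V (W y)‖ := by rw [hy]
        _ ≤ ‖V‖ * ‖W y‖ := V.le_opNorm _
        _ ≤ _ := by gcongr; linarith
    have h4 : (1 - ‖b‖ ^ 2) / (‖V‖ + 1) ^ 2 * ‖y‖ ^ 2 ≤ (1 - ‖b‖ ^ 2) * ‖W y‖ ^ 2 := by
      rw [div_mul_eq_mul_div, div_le_iff₀ (by positivity)]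
      nlinarith
    refine (sq_le_sq₀ (norm_nonneg _) (by positivity)).mp ?_
    rw [mul_pow, Real.sq_sqrt (by linarith)]
    nlinarith
  refine this.trans_lt ?_
  rw [Real.sqrt_lt' one_pos]
  linarith

/-- For a strict contraction `α ∈ L(H,K)`, the Frostman transformation `Φ_α`
maps the open unit ball of `L(H,K)` into itself, and `Φ_α⁻¹` is its compositional inverse on
strict contractions. -/
theorem stmt_10 (α : H →L[ℂ] K) (hα : ‖α‖ < 1)
    (Dα : H →L[ℂ] H) (hDα : Dα.IsPositive) (hDα2 : Dα ∘L Dα = 1 - (adjoint α) ∘L α)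
    (Dα' : K →L[ℂ] K) (hDα' : Dα'.IsPositive) (hDα'2 : Dα' ∘L Dα' = 1 - α ∘L (adjoint α)) :
    ∀ β : H →L[ℂ] K, ‖β‖ < 1 →
      ‖frostman α Dα Dα' β‖ < 1 ∧
      frostmanInv α Dα Dα' (frostman α Dα Dα' β) = β := by
  intro β hβ
  have hα' := fr_adj_lt α hα
  have hDs : adjoint Dα = Dα := hDα.isSelfAdjoint.adjoint_eq
  have hDs' : adjoint Dα' = Dα' := hDα'.isSelfAdjoint.adjoint_eq
  have uD : IsUnit Dα := by
    have h : IsUnit (Dα * Dα) := by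
      change IsUnit (Dα ∘L Dα)
      rw [hDα2]; exact fr_isUnit _ (fr_comp_lt _ _ hα' hα)
    exact isUnit_mul_self_iff.mp h
  have uD' : IsUnit Dα' := by
    have h : IsUnit (Dα' * Dα') := by
      change IsUnit (Dα' ∘L Dα')
      rw [hDα'2]; exact fr_isUnit _ (fr_comp_lt _ _ hα hα')
    exact isUnit_mul_self_iff.mp h
  have uR := fr_isUnit _ (fr_comp_lt _ _ hβ hα')
  have hI := fr_intertwine α Dα hDα hDα2 Dα' hDα' hDα'2 uD'
  have hI2 : adjoint α ∘L Dα' = Dα ∘L adjoint α := by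
    have := congrArg adjoint hI
    simpa [adjoint_comp, hDs, hDs'] using this
  obtain ⟨Φ, hΦ⟩ : ∃ Φ, Φ = frostman α Dα Dα' β := ⟨_, rfl⟩
  rw [← hΦ]
  unfold frostman at hΦ
  unfold frostmanInv
  have d1 := Ring.inverse_mul_cancel _ uD
  have d2 := Ring.mul_inverse_cancel _ uD
  have e1 := Ring.inverse_mul_cancel _ uD'
  have e2 := Ring.mul_inverse_cancel _ uD'
  have r1 := Ring.inverse_mul_cancel _ uR
  have r2 := Ring.mul_inverse_cancel _ uR
  generalize Ring.inverse Dα = d at *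
  generalize Ring.inverse Dα' = e at *
  generalize Ring.inverse (1 - β ∘L adjoint α) = R at *
  have d1x : ∀ x, d (Dα x) = x := fun x => congrArg (fun A => A x) d1
  have d2x : ∀ x, Dα (d x) = x := fun x => congrArg (fun A => A x) d2
  have e1x : ∀ x, e (Dα' x) = x := fun x => congrArg (fun A => A x) e1
  have e2x : ∀ x, Dα' (e x) = x := fun x => congrArg (fun A => A x) e2
  have r1x : ∀ x, R x - R (β (adjoint α x)) = x := fun x => by
    have := congrArg (fun A => A x) r1
    simpa using this
  have r2x : ∀ x, R x - β (adjoint α (R x)) = x := fun x => by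
    have := congrArg (fun A => A x) r2
    simpa using this
  have hIx : ∀ x, Dα' (α x) = α (Dα x) := fun x => congrArg (fun A => A x) hI
  have hI2x : ∀ x, adjoint α (Dα' x) = Dα (adjoint α x) := fun x => congrArg (fun A => A x) hI2
  have hJ : ∀ x, e (α x) = α (d x) := fun x => by
    rw [← e1x (α (d x)), hIx, d2x]
  have hds : adjoint d = d := by
    have h1 : adjoint d * Dα = 1 := by
      have := congrArg adjoint d2
      rw [mul_def, adjoint_comp, hDs, fr_adj_one] at this
      exact this
    exact left_inv_eq_right_inv h1 d2
  have hes : adjoint e = e := by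
    have h1 : adjoint e * Dα' = 1 := by
      have := congrArg adjoint e2
      rw [mul_def, adjoint_comp, hDs', fr_adj_one] at this
      exact this
    exact left_inv_eq_right_inv h1 e2
  have hN : ‖Φ‖ < 1 := by
    have f1 : (1 - β ∘L adjoint α) ∘L e ∘L Φ = (β - α) ∘L d := by
      ext x
      simp only [hΦ, comp_apply, e1x]
      exact r2x _
    have f2 : adjoint Φ ∘L e ∘L (1 - α ∘L adjoint β) = d ∘L (adjoint β - adjoint α) := by
      have := congrArg adjoint f1
      have h1 : adjoint (1 : K →L[ℂ] K) = 1 := fr_adj_one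
      simpa [adjoint_comp, hds, hes, h1, comp_assoc] using this
    have f3 : (e ∘L (1 - α ∘L adjoint β)) ∘L (adjoint R ∘L Dα') = 1 := by
      have h0 : (Dα' ∘L R) ∘L ((1 - β ∘L adjoint α) ∘L e) = 1 := by
        ext x
        have := r1x (e x)
        have h5 := congrArg Dα' this
        rw [map_sub, e2x] at h5
        simpa using h5
      have := congrArg adjoint h0
      have h1 : adjoint (1 : K →L[ℂ] K) = 1 := fr_adj_one
      simpa [adjoint_comp, hDs', hes, h1, comp_assoc] using this
    have := fr_bound (adjoint Φ) (adjoint β) (fr_adj_lt β hβ) _ _ f3 (fun z => by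
      have f2z : adjoint Φ ((e ∘L (1 - α ∘L adjoint β)) z) = d (adjoint β z) - d (adjoint α z) := by
        have := congrArg (fun A => A z) f2
        simpa using this
      have hJ2 : d (adjoint α z) = adjoint α (e z) := by
        rw [← d1x (adjoint α (e z)), ← hI2x, e2x]
      have hk := fr_key α Dα hDs hDα2 Dα' hDs' hDα'2 (e z) (d (adjoint β z))
      rw [f2z, hJ2]
      rw [e2x, d2x] at hk
      rw [← hk]
      simp [hJ])
    rwa [LinearIsometryEquiv.norm_map] at this
  refine ⟨hN, ?_⟩
  have uS : IsUnit (1 + adjoint α ∘L Φ) := by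
    have := fr_isUnit (-(adjoint α ∘L Φ)) (by rw [norm_neg]; exact fr_comp_lt _ _ hα' hN)
    simpa using this
  have s2 := Ring.mul_inverse_cancel _ uS
  generalize Ring.inverse (1 + adjoint α ∘L Φ) = S at *
  have main : ∀ x, e (Φ x + α x) = β (d (x + adjoint α (Φ x))) := fun x => by
    have h1 : d (adjoint α (Φ x)) = adjoint α (R (β (d x) - α (d x))) := by
      simp only [hΦ, comp_apply, sub_apply]
      rw [hI2x, d1x]
    rw [map_add, map_add, map_add, h1, hJ]
    have h2 : e (Φ x) = R (β (d x) - α (d x)) := by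
      simp only [hΦ, comp_apply, sub_apply, e1x]
    rw [h2]
    have h3 := r2x (β (d x) - α (d x))
    rw [sub_eq_iff_eq_add] at h3
    nth_rewrite 1 [h3]
    abel
  ext x
  have s2x : S (Dα x) + adjoint α (Φ (S (Dα x))) = Dα x := by
    have := congrArg (fun A => A (Dα x)) s2
    simpa using this
  simp only [comp_apply, add_apply]
  rw [main, s2x, d1x]

end
end

section
/- Let b be a purely contractive L(J,K)-valued Schur multiplier on 𝔹^d, α ∈ L(J,K) a pure contraction, and set b^⟨0⟩(z) := D_{b(0)*}(I - b(z)b(0)*)^{-1}(b(z) - b(0))D_{b(0)}^{-1} and b^⟨α⟩ := Φ_α^{-1} ∘ b^⟨0⟩. Then b^⟨α⟩ is again a Schur-class multiplier, and multiplication by M^⟨α⟩(z) := (I - b^⟨α⟩(z)α*)D_{α*}^{-1} = D_{α*}(I + b^⟨0⟩(z)α*)^{-1} defines a unitary multiplier from H(b^⟨0⟩) onto H(b^⟨α⟩); equivalently, I - b^⟨α⟩(z)b^⟨α⟩(w)* = D_{α*}(I + b^⟨0⟩(z)α*)^{-1}(I - b^⟨0⟩(z)b^⟨0⟩(w)*)(I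 + αb^⟨0⟩(w)*)^{-1}D_{α*}. -/
open ContinuousLinearMap
open scoped InnerProductSpace

set_option synthInstance.maxHeartbeats 1000000
set_option maxHeartbeats 1000000

noncomputable section

/-- Positivity of the de Branges-Rovnyak kernel. -/
def S18Schur {d : ℕ} {J K : Type*}
    [NormedAddCommGroup J] [InnerProductSpace ℂ J] [CompleteSpace J]
    [NormedAddCommGroup K] [InnerProductSpace ℂ K] [CompleteSpace K]
    (b : EuclideanSpace ℂ (Fin d) → (J →L[ℂ] K)) : Prop :=
  ∀ (N : ℕ) (z : Fin N → EuclideanSpace ℂ (Fin d)), (∀ i, ‖z i‖ < 1) →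
      ∀ h : Fin N → K,
        0 ≤ (∑ i, ∑ j, ⟪h i,
          (((1 - ⟪z j, z i⟫_ℂ)⁻¹ • ((1 : K →L[ℂ] K) - (b (z i)) ∘L adjoint (b (z j))))
            (h j))⟫_ℂ).re

section helpers

variable {d : ℕ} {J K : Type*}
    [NormedAddCommGroup J] [InnerProductSpace ℂ J] [CompleteSpace J]
    [NormedAddCommGroup K] [InnerProductSpace ℂ K] [CompleteSpace K]

lemma s18_one (x : K) : (1 : K →L[ℂ] K) x = x := rfl

lemma s18_mul (S T : K →L[ℂ] K) (x : K) : (S * T) x = S (T x) := rfl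

/-- Kernels transform by congruence. -/
lemma s18_transfer (b c : EuclideanSpace ℂ (Fin d) → (J →L[ℂ] K))
    (G : EuclideanSpace ℂ (Fin d) → (K →L[ℂ] K))
    (hG : ∀ z w : EuclideanSpace ℂ (Fin d), ‖z‖ < 1 → ‖w‖ < 1 →
      (1 : K →L[ℂ] K) - (c z) ∘L adjoint (c w)
        = G z ∘L (1 - (b z) ∘L adjoint (b w)) ∘L adjoint (G w))
    (hb : S18Schur b) : S18Schur c := by
  intro N z hz h
  have := hb N z hz (fun i => adjoint (G (z i)) (h i))
  refine this.trans_eq ?_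
  congr 1
  refine Finset.sum_congr rfl fun i _ => Finset.sum_congr rfl fun j _ => ?_
  rw [hG _ _ (hz i) (hz j), adjoint_inner_left]
  simp only [smul_apply, map_smul, comp_apply]

lemma s18_pow {N : ℕ} (z : Fin N → EuclideanSpace ℂ (Fin d)) (n : ℕ) :
    ∀ h : Fin N → K, 0 ≤ (∑ i, ∑ j, ⟪z j, z i⟫_ℂ ^ n * ⟪h i, h j⟫_ℂ).re := by
  induction n with
  | zero =>
    intro h
    have : (∑ i, ∑ j, ⟪z j, z i⟫_ℂ ^ 0 * ⟪h i, h j⟫_ℂ) = ⟪∑ i, h i, ∑ j, h j⟫_ℂ := by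
      rw [sum_inner]
      simp only [inner_sum, pow_zero, one_mul]
    rw [this]
    exact inner_self_nonneg (𝕜 := ℂ) (x := ∑ i, h i)
  | succ n ih =>
    intro h
    have : (∑ i, ∑ j, ⟪z j, z i⟫_ℂ ^ (n+1) * ⟪h i, h j⟫_ℂ)
        = ∑ k : Fin d, ∑ i, ∑ j, ⟪z j, z i⟫_ℂ ^ n *
          ⟪(starRingEnd ℂ (z i k)) • h i, (starRingEnd ℂ (z j k)) • h j⟫_ℂ := by
      symm
      rw [Finset.sum_comm]
      refine Finset.sum_congr rfl fun i _ => ?_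
      rw [Finset.sum_comm]
      refine Finset.sum_congr rfl fun j _ => ?_
      symm
      rw [pow_succ, PiLp.inner_apply, mul_assoc, Finset.sum_mul, Finset.mul_sum]
      refine Finset.sum_congr rfl fun k _ => ?_
      simp only [inner_smul_left, inner_smul_right, RCLike.inner_apply, Complex.conj_conj]
      ring
    rw [this, Complex.re_sum]
    exact Finset.sum_nonneg fun k _ => ih _

lemma s18_zero : S18Schur (fun _ => 0 : EuclideanSpace ℂ (Fin d) → (J →L[ℂ] K)) := by
  intro N z hz h
  have hs : ∀ i j, HasSum (fun n : ℕ => ⟪z j, z i⟫_ℂ ^ n * ⟪h i, h j⟫_ℂ)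
      ((1 - ⟪z j, z i⟫_ℂ)⁻¹ * ⟪h i, h j⟫_ℂ) := by
    intro i j
    have hlt : ‖⟪z j, z i⟫_ℂ‖ < 1 := by
      refine (norm_inner_le_norm _ _).trans_lt ?_
      have := hz i; have := hz j
      have := norm_nonneg (z i); have := norm_nonneg (z j)
      nlinarith
    have hg : HasSum (fun n : ℕ => ⟪z j, z i⟫_ℂ ^ n) (1 - ⟪z j, z i⟫_ℂ)⁻¹ :=
      hasSum_geometric_of_norm_lt_one hlt
    exact hg.mul_right ⟪h i, h j⟫_ℂ
  have hs2 : HasSum (fun n : ℕ => ∑ i, ∑ j, ⟪z j, z i⟫_ℂ ^ n * ⟪h i, h j⟫_ℂ)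
      (∑ i, ∑ j, (1 - ⟪z j, z i⟫_ℂ)⁻¹ * ⟪h i, h j⟫_ℂ) :=
    hasSum_sum fun i _ => hasSum_sum fun j _ => hs i j
  have hs3 := Complex.hasSum_re hs2
  have h4 : 0 ≤ (∑ i, ∑ j, (1 - ⟪z j, z i⟫_ℂ)⁻¹ * ⟪h i, h j⟫_ℂ).re :=
    hs3.nonneg fun n => s18_pow z n h
  refine h4.trans_eq ?_
  congr 1
  refine Finset.sum_congr rfl fun i _ => Finset.sum_congr rfl fun j _ => ?_
  simp only [zero_comp, sub_zero, smul_apply, s18_one, inner_smul_right]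

/-- The two-point inequality with one of the points being the origin. -/
lemma s18_two (b : EuclideanSpace ℂ (Fin d) → (J →L[ℂ] K)) (hb : S18Schur b)
    (z : EuclideanSpace ℂ (Fin d)) (hz : ‖z‖ < 1) (h k : K) :
    0 ≤ (‖h‖ ^ 2 - ‖adjoint (b 0) h‖ ^ 2)
      + 2 * (⟪k, h - b z (adjoint (b 0) h)⟫_ℂ).re
      + (1 - ‖z‖ ^ 2)⁻¹ * (‖k‖ ^ 2 - ‖adjoint (b z) k‖ ^ 2) := by
  have := hb 2 ![0, z] (by intro i; fin_cases i <;> simp [hz]) ![h, k]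
  refine this.trans_eq ?_
  have e1 : ∀ (T : J →L[ℂ] K) (x : K), ⟪x, T (adjoint T x)⟫_ℂ = ((‖adjoint T x‖ ^ 2 : ℝ) : ℂ) := by
    intro T x
    rw [← adjoint_inner_left, inner_self_eq_norm_sq_to_K]; simp
  have e2 : ∀ (x : K), ⟪x, x⟫_ℂ = ((‖x‖ ^ 2 : ℝ) : ℂ) := by
    intro x; rw [inner_self_eq_norm_sq_to_K]; simp
  have e3 : (⟪h, b 0 (adjoint (b z) k)⟫_ℂ).re = (⟪k, b z (adjoint (b 0) h)⟫_ℂ).re := by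
    rw [← adjoint_inner_left, ← Complex.conj_re, inner_conj_symm, adjoint_inner_left]
  have e4 : (⟪h, k⟫_ℂ).re = (⟪k, h⟫_ℂ).re := by
    rw [← Complex.conj_re, inner_conj_symm]
  have e5 : (1 - ⟪z, z⟫_ℂ)⁻¹ = (((1 - ‖z‖ ^ 2)⁻¹ : ℝ) : ℂ) := by
    rw [inner_self_eq_norm_sq_to_K]; simp
  simp only [Fin.sum_univ_two, Matrix.cons_val_zero, Matrix.cons_val_one, inner_zero_left,
    inner_zero_right, sub_zero, inv_one, one_mul, smul_apply, sub_apply, s18_one, comp_apply,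
    inner_sub_right, inner_smul_right, e1, e2, e5, Complex.add_re, Complex.sub_re,
    Complex.ofReal_re, Complex.re_ofReal_mul, e3, e4]
  ring

/-- Injectivity of defect operators on the domain side. -/
lemma s18_inj (α : J →L[ℂ] K) (hα : ∀ h : J, h ≠ 0 → ‖α h‖ < ‖h‖)
    (D : J →L[ℂ] J) (hD2 : D ∘L D = 1 - (adjoint α) ∘L α) (x : J) (hx : D x = 0) : x = 0 := by
  by_contra hne
  have h1 := congrArg (fun T : J →L[ℂ] J => T x) hD2
  simp only [comp_apply, hx, map_zero, sub_apply, s18_one] at h1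
  have h2 : ⟪x, x⟫_ℂ = ⟪α x, α x⟫_ℂ := by
    rw [← adjoint_inner_right, ← sub_eq_zero, ← inner_sub_right, ← h1, inner_zero_right]
  rw [inner_self_eq_norm_sq_to_K, inner_self_eq_norm_sq_to_K] at h2
  have h3 : ‖x‖ ^ 2 = ‖α x‖ ^ 2 := by exact_mod_cast h2
  have := hα x hne
  have := norm_nonneg (α x)
  nlinarith

/-- The adjoint of a pure contraction is a pure contraction; defect operators are injective. -/
lemma s18_inj' (α : J →L[ℂ] K) (hα : ∀ h : J, h ≠ 0 → ‖α h‖ < ‖h‖)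
    (D : K →L[ℂ] K) (hD2 : D ∘L D = 1 - α ∘L (adjoint α)) (x : K) (hx : D x = 0) : x = 0 := by
  have h1 := congrArg (fun T : K →L[ℂ] K => T x) hD2
  simp only [comp_apply, hx, map_zero, sub_apply, s18_one] at h1
  have h1' : α (adjoint α x) = x := (sub_eq_zero.mp h1.symm).symm
  by_cases h0 : adjoint α x = 0
  · rw [← h1', h0, map_zero]
  exfalso
  have h2 : ⟪adjoint α x, adjoint α x⟫_ℂ = ⟪x, x⟫_ℂ := by
    rw [adjoint_inner_left, h1']
  rw [inner_self_eq_norm_sq_to_K, inner_self_eq_norm_sq_to_K] at h2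
  have h3 : ‖adjoint α x‖ ^ 2 = ‖x‖ ^ 2 := by exact_mod_cast h2
  have h4 := hα _ h0
  rw [h1'] at h4
  have := norm_nonneg x
  nlinarith

/-- Intertwining of defect operators. -/
lemma s18_intertwine (α : J →L[ℂ] K) (hα : ∀ h : J, h ≠ 0 → ‖α h‖ < ‖h‖)
    (D : J →L[ℂ] J) (hD : D.IsPositive) (hD2 : D ∘L D = 1 - (adjoint α) ∘L α)
    (D' : K →L[ℂ] K) (hD' : D'.IsPositive) (hD'2 : D' ∘L D' = 1 - α ∘L (adjoint α)) :
    D' ∘L α = α ∘L D := by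
  set Y : J →L[ℂ] K := D' ∘L α - α ∘L D with hY
  have hDx : ∀ x, D (D x) = x - adjoint α (α x) := fun x =>
    congrArg (fun T : J →L[ℂ] J => T x) hD2
  have hD'x : ∀ x, D' (D' x) = x - α (adjoint α x) := fun x =>
    congrArg (fun T : K →L[ℂ] K => T x) hD'2
  have hsyl : D' ∘L Y = - (Y ∘L D) := by
    ext x
    simp only [hY, comp_apply, sub_apply, neg_apply, map_sub, hDx, hD'x]
    abel
  set Q : K →L[ℂ] K := Y ∘L adjoint Y with hQ
  have hQpos : Q.IsPositive := isPositive_self_comp_adjoint Y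
  have hP : (Y ∘L D ∘L adjoint Y).IsPositive := hD.conj_adjoint Y
  have hDQ : D' * Q = - (Y ∘L D ∘L adjoint Y) := by
    change D' ∘L (Y ∘L adjoint Y) = _
    rw [← comp_assoc, hsyl, neg_comp, comp_assoc]
  have hcomm : Commute D' Q := by
    have h1 : star (D' * Q) = D' * Q := by
      rw [hDQ, star_neg, hP.isSelfAdjoint.star_eq]
    rw [star_mul, hQpos.isSelfAdjoint.star_eq, hD'.isSelfAdjoint.star_eq] at h1
    exact h1.symm
  have hnn : 0 ≤ D' * Q := Commute.mul_nonneg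
    ((nonneg_iff_isPositive _).2 hD') ((nonneg_iff_isPositive _).2 hQpos) hcomm
  have hnp : D' * Q ≤ 0 := by
    rw [hDQ]
    exact neg_nonpos.2 ((nonneg_iff_isPositive _).2 hP)
  have h0 : D' * Q = 0 := le_antisymm hnp hnn
  have hYs : adjoint Y = 0 := by
    ext x
    have h1 : D' (Q x) = 0 := congrArg (fun T : K →L[ℂ] K => T x) h0
    have h2 := s18_inj' α hα D' hD'2 _ h1
    have h3 : ⟪adjoint Y x, adjoint Y x⟫_ℂ = 0 := by
      rw [adjoint_inner_left]
      change ⟪x, Q x⟫_ℂ = 0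
      rw [h2, inner_zero_right]
    simpa using h3
  have : Y = 0 := by
    rw [← adjoint_adjoint Y, hYs, map_zero]
  exact sub_eq_zero.mp this

/-- Right cancellation of an injective self-adjoint operator. -/
lemma s18_cancel (D : J →L[ℂ] J) (hD : D.IsPositive) (hinj : ∀ x, D x = 0 → x = 0)
    (S T : J →L[ℂ] K) (h : S ∘L D = T ∘L D) : S = T := by
  have h1 : (S - T) ∘L D = 0 := by rw [sub_comp, h, sub_self]
  have h2 : D ∘L adjoint (S - T) = 0 := by
    have := congrArg adjoint h1
    rwa [adjoint_comp, hD.isSelfAdjoint.adjoint_eq, map_zero] at this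
  have h3 : adjoint (S - T) = 0 := by
    ext x
    exact hinj _ (congrArg (fun T : K →L[ℂ] J => T x) h2)
  rw [← sub_eq_zero, ← adjoint_adjoint (S - T), h3, map_zero]

/-- The Crofoot identities. -/
lemma s18_crofoot (α : J →L[ℂ] K)
    (D : J →L[ℂ] J) (hD : D.IsPositive) (hD2 : D ∘L D = 1 - (adjoint α) ∘L α)
    (D' : K →L[ℂ] K) (hD' : D'.IsPositive) (hD'2 : D' ∘L D' = 1 - α ∘L (adjoint α))
    (hi : D' ∘L α = α ∘L D)
    (B C E F : J →L[ℂ] K)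
    (hB : IsUnit (1 + B ∘L adjoint α)) (hC : IsUnit (1 + C ∘L adjoint α))
    (hE : E = α + D' ∘L Ring.inverse (1 + B ∘L adjoint α) ∘L B ∘L D)
    (hF : F = α + D' ∘L Ring.inverse (1 + C ∘L adjoint α) ∘L C ∘L D) :
    (1 : K →L[ℂ] K) - E ∘L adjoint F
      = D' ∘L (Ring.inverse (1 + B ∘L adjoint α)) ∘L (1 - B ∘L adjoint C) ∘L
          (Ring.inverse (1 + α ∘L adjoint C)) ∘L D' ∧
    (1 : K →L[ℂ] K) - E ∘L adjoint α = D' ∘L (Ring.inverse (1 + B ∘L adjoint α)) ∘L D' ∧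
    Ring.inverse (1 + α ∘L adjoint C) = adjoint (Ring.inverse (1 + C ∘L adjoint α)) := by
  have hDx : ∀ x, D (D x) = x - adjoint α (α x) := fun x =>
    congrArg (fun T : J →L[ℂ] J => T x) hD2
  have hD'x : ∀ x, α (adjoint α x) = x - D' (D' x) := fun x => by
    rw [show D' (D' x) = x - α (adjoint α x) from congrArg (fun T : K →L[ℂ] K => T x) hD'2]
    abel
  have hix : ∀ x, α (D x) = D' (α x) := fun x =>
    (congrArg (fun T : J →L[ℂ] K => T x) hi).symm
  have hi' : D ∘L adjoint α = adjoint α ∘L D' := by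
    have := congrArg adjoint hi
    rw [adjoint_comp, adjoint_comp, hD.isSelfAdjoint.adjoint_eq, hD'.isSelfAdjoint.adjoint_eq] at this
    exact this.symm
  have hi'x : ∀ x, D (adjoint α x) = adjoint α (D' x) := fun x =>
    congrArg (fun T : K →L[ℂ] J => T x) hi'
  have hCs : star (1 + C ∘L adjoint α) = 1 + α ∘L adjoint C := by
    rw [star_add, star_one, star_eq_adjoint, adjoint_comp, adjoint_adjoint]
  have hinv : Ring.inverse (1 + α ∘L adjoint C) = adjoint (Ring.inverse (1 + C ∘L adjoint α)) := by
    rw [← hCs, Ring.inverse_star, star_eq_adjoint]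
  have hC' : IsUnit (1 + α ∘L adjoint C) := hCs ▸ hC.star
  have hFs : adjoint F = adjoint α
      + D ∘L adjoint C ∘L Ring.inverse (1 + α ∘L adjoint C) ∘L D' := by
    rw [hF, hinv, map_add]
    simp only [adjoint_comp, hD.isSelfAdjoint.adjoint_eq, hD'.isSelfAdjoint.adjoint_eq, comp_assoc]
  have hR : ∀ y, Ring.inverse (1 + B ∘L adjoint α) (B (adjoint α y))
      = y - Ring.inverse (1 + B ∘L adjoint α) y := fun y => by
    have := congrArg (fun T : K →L[ℂ] K => T y) (Ring.inverse_mul_cancel _ hB)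
    simp only [s18_mul, add_apply, s18_one, comp_apply, map_add] at this
    rw [eq_sub_iff_add_eq, add_comm]; exact this
  have hR' : ∀ y, α (adjoint C (Ring.inverse (1 + α ∘L adjoint C) y))
      = y - Ring.inverse (1 + α ∘L adjoint C) y := fun y => by
    have := congrArg (fun T : K →L[ℂ] K => T y) (Ring.mul_inverse_cancel _ hC')
    simp only [s18_mul, add_apply, s18_one, comp_apply] at this
    rw [eq_sub_iff_add_eq, add_comm]; exact this
  refine ⟨?_, ?_, hinv⟩
  · rw [hFs, hE]
    generalize Ring.inverse (1 + B ∘L adjoint α) = R at *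
    generalize Ring.inverse (1 + α ∘L adjoint C) = R' at *
    ext x
    simp only [comp_apply, sub_apply, add_apply, s18_one, map_sub, map_add, hDx, hD'x, hix,
      hi'x, hR, hR']
    abel
  · rw [hE]
    generalize Ring.inverse (1 + B ∘L adjoint α) = R at *
    ext x
    simp only [comp_apply, sub_apply, add_apply, s18_one, map_sub, map_add, hDx, hD'x, hix,
      hi'x, hR]
    abel

lemma s18_unit (B α : J →L[ℂ] K) (h : ‖B‖ * ‖α‖ < 1) :
    IsUnit (1 + B ∘L adjoint α) ∧ IsUnit (1 + adjoint α ∘L B) := by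
  have e : ‖adjoint α‖ = ‖α‖ := LinearIsometryEquiv.norm_map adjoint α
  constructor
  · have : ‖-(B ∘L adjoint α)‖ < 1 := by
      rw [norm_neg]
      refine (opNorm_comp_le _ _).trans_lt ?_
      rwa [e]
    simpa using isUnit_one_sub_of_norm_lt_one this
  · have : ‖-(adjoint α ∘L B)‖ < 1 := by
      rw [norm_neg]
      refine (opNorm_comp_le _ _).trans_lt ?_
      rwa [e, mul_comm]
    simpa using isUnit_one_sub_of_norm_lt_one this

/-- Explicit form of `Φ_α⁻¹` from the left-multiplied definition. -/
lemma s18_form_left (α : J →L[ℂ] K)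
    (D : J →L[ℂ] J) (D' : K →L[ℂ] K) (hD'2 : D' ∘L D' = 1 - α ∘L (adjoint α))
    (hi : D' ∘L α = α ∘L D) (hinj : ∀ x, D' x = 0 → x = 0)
    (B E : J →L[ℂ] K)
    (hB : IsUnit (1 + B ∘L adjoint α)) (hB' : IsUnit (1 + adjoint α ∘L B))
    (hE : D' ∘L E = (B + α) ∘L (Ring.inverse (1 + (adjoint α) ∘L B)) ∘L D) :
    E = α + D' ∘L Ring.inverse (1 + B ∘L adjoint α) ∘L B ∘L D := by
  have hD'x : ∀ x, D' (D' x) = x - α (adjoint α x) := fun x =>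
    congrArg (fun T : K →L[ℂ] K => T x) hD'2
  have hix : ∀ x, D' (α x) = α (D x) := fun x =>
    (congrArg (fun T : J →L[ℂ] K => T x) hi)
  have hS : ∀ y, adjoint α (B (Ring.inverse (1 + adjoint α ∘L B) y))
      = y - Ring.inverse (1 + adjoint α ∘L B) y := fun y => by
    have := congrArg (fun T : J →L[ℂ] J => T y) (Ring.mul_inverse_cancel _ hB')
    simp only [s18_mul, add_apply, s18_one, comp_apply] at this
    rw [eq_sub_iff_add_eq, add_comm]; exact this
  have hR : ∀ y, Ring.inverse (1 + B ∘L adjoint α) (y + B (adjoint α y)) = y := fun y => by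
    have := congrArg (fun T : K →L[ℂ] K => T y) (Ring.inverse_mul_cancel _ hB)
    simpa only [s18_mul, add_apply, s18_one, comp_apply] using this
  have hRB : ∀ y, Ring.inverse (1 + B ∘L adjoint α) (B y)
      = B (Ring.inverse (1 + adjoint α ∘L B) y) := fun y => by
    rw [← hR (B (Ring.inverse (1 + adjoint α ∘L B) y)), hS, map_sub, add_sub_cancel]
  have hEx : ∀ x, D' (E x) = B (Ring.inverse (1 + (adjoint α) ∘L B) (D x))
      + α (Ring.inverse (1 + (adjoint α) ∘L B) (D x)) := fun x =>
    congrArg (fun T : J →L[ℂ] K => T x) hE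
  ext x
  rw [← sub_eq_zero]
  apply hinj
  simp only [comp_apply, add_apply, map_sub, map_add, hD'x, hix, hRB, hS, hEx]
  abel

/-- Explicit form of `Φ_α⁻¹` from the right-multiplied definition. -/
lemma s18_form_right (α : J →L[ℂ] K)
    (D : J →L[ℂ] J) (hD : D.IsPositive) (hD2 : D ∘L D = 1 - (adjoint α) ∘L α)
    (D' : K →L[ℂ] K)
    (hi : D' ∘L α = α ∘L D) (hinj : ∀ x, D x = 0 → x = 0)
    (B E : J →L[ℂ] K)
    (hB : IsUnit (1 + B ∘L adjoint α))
    (hE : E ∘L D = D' ∘L (Ring.inverse (1 + B ∘L adjoint α)) ∘L (B + α)) :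
    E = α + D' ∘L Ring.inverse (1 + B ∘L adjoint α) ∘L B ∘L D := by
  apply s18_cancel D hD hinj
  rw [hE]
  have hDx : ∀ x, D (D x) = x - adjoint α (α x) := fun x =>
    congrArg (fun T : J →L[ℂ] J => T x) hD2
  have hix : ∀ x, D' (α x) = α (D x) := fun x =>
    (congrArg (fun T : J →L[ℂ] K => T x) hi)
  have hR : ∀ y, Ring.inverse (1 + B ∘L adjoint α) (B (adjoint α y))
      = y - Ring.inverse (1 + B ∘L adjoint α) y := fun y => by
    have := congrArg (fun T : K →L[ℂ] K => T y) (Ring.inverse_mul_cancel _ hB)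
    simp only [s18_mul, add_apply, s18_one, comp_apply, map_add] at this
    rw [eq_sub_iff_add_eq, add_comm]; exact this
  ext x
  simp only [comp_apply, add_apply, map_sub, map_add, hDx, ← hix, hR]
  abel

/-- If `1 - b(z) b(0)*` is invertible for some `z` then `b(0)` is a strict contraction. -/
lemma s18_strict (b : EuclideanSpace ℂ (Fin d) → (J →L[ℂ] K)) (hb : S18Schur b)
    (z : EuclideanSpace ℂ (Fin d)) (hz : ‖z‖ < 1)
    (hu : IsUnit (1 - b z ∘L adjoint (b 0))) : ‖b 0‖ < 1 := by
  set V := Ring.inverse (1 - b z ∘L adjoint (b 0)) with hV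
  have hs : 0 < 1 - ‖z‖ ^ 2 := by have := norm_nonneg z; nlinarith
  set s := 1 - ‖z‖ ^ 2 with hsdef
  have hmain : ∀ h : K, s * ‖h - b z (adjoint (b 0) h)‖ ^ 2 ≤ ‖h‖ ^ 2 - ‖adjoint (b 0) h‖ ^ 2 := by
    intro h
    set u := h - b z (adjoint (b 0) h) with hu
    have h1 := s18_two b hb z hz h (-((s : ℂ) • u))
    rw [← hu, inner_neg_left, inner_smul_left, norm_neg, norm_smul, inner_self_eq_norm_sq_to_K,
      ← hsdef] at h1
    have h2 : (-((starRingEnd ℂ) (s : ℂ) * ((‖u‖ : ℂ)) ^ 2)).re = -(s * ‖u‖ ^ 2) := by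
      rw [Complex.conj_ofReal, ← Complex.ofReal_pow, ← Complex.ofReal_mul, Complex.neg_re,
        Complex.ofReal_re]
    have h3 : ‖(s : ℂ)‖ = s := by simp [abs_of_pos hs]
    erw [h2] at h1
    rw [h3] at h1
    have h4 : s⁻¹ * ((s * ‖u‖) ^ 2 - ‖adjoint (b z) (-((s : ℂ) • u))‖ ^ 2) ≤ s * ‖u‖ ^ 2 := by
      rw [inv_mul_le_iff₀ hs]
      nlinarith [sq_nonneg ‖adjoint (b z) (-((s : ℂ) • u))‖]
    linarith
  have hVh : ∀ h : K, ‖h‖ ≤ ‖V‖ * ‖h - b z (adjoint (b 0) h)‖ := by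
    intro h
    have : V (h - b z (adjoint (b 0) h)) = h :=
      congrArg (fun T : K →L[ℂ] K => T h) (Ring.inverse_mul_cancel _ hu)
    calc ‖h‖ = ‖V (h - b z (adjoint (b 0) h))‖ := by rw [this]
      _ ≤ _ := V.le_opNorm _
  set m := ‖V‖ + 1 with hm
  have hm1 : 1 ≤ m := by have := norm_nonneg V; linarith
  have hs1 : s ≤ 1 := by have := sq_nonneg ‖z‖; linarith
  have hq0 : 0 < s / m ^ 2 := by positivity
  have hq1 : s / m ^ 2 ≤ 1 := by
    rw [div_le_one (by positivity)]; nlinarith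
  have hbd : ‖adjoint (b 0)‖ ≤ √(1 - s / m ^ 2) := by
    refine opNorm_le_bound _ (Real.sqrt_nonneg _) fun h => ?_
    refine abs_le_of_sq_le_sq' ?_ (by positivity) |>.2
    rw [mul_pow, Real.sq_sqrt (by linarith)]
    have h1 := hmain h
    have h2 : ‖h‖ ≤ m * ‖h - b z (adjoint (b 0) h)‖ :=
      (hVh h).trans (by gcongr; linarith)
    have h3 : ‖h‖ ^ 2 ≤ m ^ 2 * ‖h - b z (adjoint (b 0) h)‖ ^ 2 := by
      rw [← mul_pow]; gcongr
    have h4 : s / m ^ 2 * ‖h‖ ^ 2 ≤ s * ‖h - b z (adjoint (b 0) h)‖ ^ 2 := by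
      calc s / m ^ 2 * ‖h‖ ^ 2 ≤ s / m ^ 2 * (m ^ 2 * ‖h - b z (adjoint (b 0) h)‖ ^ 2) := by gcongr
        _ = _ := by field_simp
    linarith
  have e : ‖adjoint (b 0)‖ = ‖b 0‖ := LinearIsometryEquiv.norm_map adjoint (b 0)
  rw [← e]
  refine hbd.trans_lt ?_
  rw [Real.sqrt_lt' one_pos]
  linarith

/-- Schwarz lemma. -/
lemma s18_schwarz (b : EuclideanSpace ℂ (Fin d) → (J →L[ℂ] K)) (hb : S18Schur b) (h0 : b 0 = 0)
    (z : EuclideanSpace ℂ (Fin d)) (hz : ‖z‖ < 1) : ‖b z‖ < 1 := by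
  have hs : 0 < 1 - ‖z‖ ^ 2 := by have := norm_nonneg z; nlinarith
  have e : ‖adjoint (b z)‖ = ‖b z‖ := LinearIsometryEquiv.norm_map adjoint (b z)
  rw [← e]
  refine lt_of_le_of_lt (opNorm_le_bound _ (norm_nonneg z) fun k => ?_) hz
  refine abs_le_of_sq_le_sq' ?_ (by positivity) |>.2
  have h1 := s18_two b hb z hz (-k) k
  have h2 : (⟪k, -k⟫_ℂ).re = - ‖k‖ ^ 2 := by
    rw [inner_neg_right, Complex.neg_re]
    congr 1
    exact (norm_sq_eq_re_inner (𝕜 := ℂ) k).symm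
  simp only [h0, map_zero, zero_apply, sub_zero, norm_neg, norm_zero, h2] at h1
  have h3 : ‖k‖ ^ 2 ≤ (1 - ‖z‖ ^ 2)⁻¹ * (‖k‖ ^ 2 - ‖adjoint (b z) k‖ ^ 2) := by linarith
  rw [inv_mul_eq_div, le_div_iff₀ hs] at h3
  rw [mul_pow]
  linarith

lemma s18_norm_le (α : J →L[ℂ] K) (hα : ∀ h : J, h ≠ 0 → ‖α h‖ < ‖h‖) : ‖α‖ ≤ 1 := by
  refine opNorm_le_bound _ zero_le_one fun h => ?_
  by_cases h0 : h = 0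
  · simp [h0]
  · rw [one_mul]; exact (hα h h0).le

end helpers

/-- Let `b` be a purely contractive Schur multiplier, `α` a pure contraction,
`b⁰(z) = D_{b(0)*}(1 - b(z)b(0)*)⁻¹(b(z) - b(0))D_{b(0)}⁻¹` and `b^⟨α⟩ = Φ_α⁻¹ ∘ b⁰`.  Then
`b^⟨α⟩` is again Schur class, and the Crofoot multiplier identity
`1 - b^⟨α⟩(z)b^⟨α⟩(w)* = D_{α*}(1 + b⁰(z)α*)⁻¹(1 - b⁰(z)b⁰(w)*)(1 + α b⁰(w)*)⁻¹D_{α*}` holds,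
together with `(1 - b^⟨α⟩(z)α*) = D_{α*}(1 + b⁰(z)α*)⁻¹D_{α*}` (`M^⟨α⟩` is a unitary
multiplier `H(b⁰) → H(b^⟨α⟩)`). -/
theorem stmt_18 {d : ℕ} {J K : Type*}
    [NormedAddCommGroup J] [InnerProductSpace ℂ J] [CompleteSpace J]
    [NormedAddCommGroup K] [InnerProductSpace ℂ K] [CompleteSpace K]
    (b : EuclideanSpace ℂ (Fin d) → (J →L[ℂ] K))
    (hbpos : ∀ (N : ℕ) (z : Fin N → EuclideanSpace ℂ (Fin d)), (∀ i, ‖z i‖ < 1) →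
      ∀ h : Fin N → K,
        0 ≤ (∑ i, ∑ j, ⟪h i,
          (((1 - ⟪z j, z i⟫_ℂ)⁻¹ • ((1 : K →L[ℂ] K) - (b (z i)) ∘L adjoint (b (z j))))
            (h j))⟫_ℂ).re)
    (hbpure : ∀ z : EuclideanSpace ℂ (Fin d), ‖z‖ < 1 → ∀ h : J, h ≠ 0 → ‖b z h‖ < ‖h‖)
    (α : J →L[ℂ] K) (hα : ∀ h : J, h ≠ 0 → ‖α h‖ < ‖h‖)
    (Db0 : J →L[ℂ] J) (hDb0 : Db0.IsPositive)
    (hDb02 : Db0 ∘L Db0 = 1 - (adjoint (b 0)) ∘L (b 0))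
    (Db0' : K →L[ℂ] K) (hDb0' : Db0'.IsPositive)
    (hDb0'2 : Db0' ∘L Db0' = 1 - (b 0) ∘L (adjoint (b 0)))
    (Dα : J →L[ℂ] J) (hDα : Dα.IsPositive) (hDα2 : Dα ∘L Dα = 1 - (adjoint α) ∘L α)
    (Dα' : K →L[ℂ] K) (hDα' : Dα'.IsPositive) (hDα'2 : Dα' ∘L Dα' = 1 - α ∘L (adjoint α))
    (b0 : EuclideanSpace ℂ (Fin d) → (J →L[ℂ] K))
    (hb0def : ∀ z : EuclideanSpace ℂ (Fin d), ‖z‖ < 1 →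
      (b0 z) ∘L Db0
        = Db0' ∘L (Ring.inverse (1 - (b z) ∘L adjoint (b 0))) ∘L (b z - b 0))
    (c : EuclideanSpace ℂ (Fin d) → (J →L[ℂ] K))
    (hcdef : ∀ z : EuclideanSpace ℂ (Fin d), ‖z‖ < 1 →
      Dα' ∘L (c z)
        = (b0 z + α) ∘L (Ring.inverse (1 + (adjoint α) ∘L (b0 z))) ∘L Dα) :
    (∀ (N : ℕ) (z : Fin N → EuclideanSpace ℂ (Fin d)), (∀ i, ‖z i‖ < 1) →
      ∀ h : Fin N → K,
        0 ≤ (∑ i, ∑ j, ⟪h i,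
          (((1 - ⟪z j, z i⟫_ℂ)⁻¹ • ((1 : K →L[ℂ] K) - (c (z i)) ∘L adjoint (c (z j))))
            (h j))⟫_ℂ).re) ∧
    (∀ z w : EuclideanSpace ℂ (Fin d), ‖z‖ < 1 → ‖w‖ < 1 →
      (1 : K →L[ℂ] K) - (c z) ∘L adjoint (c w)
        = Dα' ∘L (Ring.inverse (1 + (b0 z) ∘L adjoint α)) ∘L
            (1 - (b0 z) ∘L adjoint (b0 w)) ∘L
            (Ring.inverse (1 + α ∘L adjoint (b0 w))) ∘L Dα') ∧
    (∀ z : EuclideanSpace ℂ (Fin d), ‖z‖ < 1 →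
      (1 : K →L[ℂ] K) - (c z) ∘L adjoint α
        = Dα' ∘L (Ring.inverse (1 + (b0 z) ∘L adjoint α)) ∘L Dα') := by
  have hib : ∀ x, Db0 x = 0 → x = 0 := s18_inj (b 0) (hbpure 0 (by simp)) Db0 hDb02
  have hb00 : b0 0 = 0 := by
    apply s18_cancel Db0 hDb0 hib
    rw [hb0def 0 (by simp), sub_self, comp_zero, comp_zero, zero_comp]
  have hS0 : S18Schur b0 := by
    by_cases hlt : ‖b 0‖ < 1
    · have hu : ∀ z : EuclideanSpace ℂ (Fin d), ‖z‖ < 1 →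
          IsUnit (1 + b z ∘L adjoint (-(b 0))) := fun z hz => by
        refine (s18_unit _ _ ?_).1
        rw [norm_neg]
        have := s18_norm_le (b z) (hbpure z hz)
        have := norm_nonneg (b 0)
        nlinarith
      have hp : ∀ h : J, h ≠ 0 → ‖(-(b 0)) h‖ < ‖h‖ := fun h h0 => by
        rw [neg_apply, norm_neg]; exact hbpure 0 (by simp) h h0
      have h2 : Db0 ∘L Db0 = 1 - adjoint (-(b 0)) ∘L (-(b 0)) := by
        rw [hDb02, map_neg, neg_comp, comp_neg, neg_neg]
      have h2' : Db0' ∘L Db0' = 1 - (-(b 0)) ∘L adjoint (-(b 0)) := by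
        rw [hDb0'2, map_neg, neg_comp, comp_neg, neg_neg]
      have hi := s18_intertwine (-(b 0)) hp Db0 hDb0 h2 Db0' hDb0' h2'
      have hform : ∀ z : EuclideanSpace ℂ (Fin d), ‖z‖ < 1 → b0 z = -(b 0) +
          Db0' ∘L Ring.inverse (1 + b z ∘L adjoint (-(b 0))) ∘L b z ∘L Db0 := fun z hz => by
        refine s18_form_right (-(b 0)) Db0 hDb0 h2 Db0' hi hib (b z) (b0 z) (hu z hz) ?_
        rw [hb0def z hz, map_neg, comp_neg, ← sub_eq_add_neg, ← sub_eq_add_neg]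
      refine s18_transfer b b0
        (fun z => Db0' ∘L Ring.inverse (1 + b z ∘L adjoint (-(b 0)))) ?_ hbpos
      intro z w hz hw
      obtain ⟨h3, -, h4⟩ := s18_crofoot (-(b 0)) Db0 hDb0 h2 Db0' hDb0' h2' hi (b z) (b w)
        (b0 z) (b0 w) (hu z hz) (hu w hw) (hform z hz) (hform w hw)
      rw [h3, h4, adjoint_comp, hDb0'.isSelfAdjoint.adjoint_eq]
      simp only [comp_assoc]
    · have hz0 : ∀ z : EuclideanSpace ℂ (Fin d), ‖z‖ < 1 → b0 z = 0 := fun z hz => by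
        apply s18_cancel Db0 hDb0 hib
        rw [hb0def z hz, Ring.inverse_non_unit _ fun hu => hlt (s18_strict b hbpos z hz hu),
          zero_comp, comp_zero, zero_comp]
      refine s18_transfer (fun _ => 0) b0 (fun _ => 1) ?_ s18_zero
      intro z w hz hw
      rw [hz0 z hz, hz0 w hw]
      ext x
      simp [← star_eq_adjoint]
  have hu : ∀ z : EuclideanSpace ℂ (Fin d), ‖z‖ < 1 →
      IsUnit (1 + b0 z ∘L adjoint α) ∧ IsUnit (1 + adjoint α ∘L b0 z) := fun z hz => by
    refine s18_unit _ _ ?_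
    have := s18_schwarz b0 hS0 hb00 z hz
    have := s18_norm_le α hα
    have := norm_nonneg (b0 z)
    have := norm_nonneg α
    nlinarith
  have hi := s18_intertwine α hα Dα hDα hDα2 Dα' hDα' hDα'2
  have hform : ∀ z : EuclideanSpace ℂ (Fin d), ‖z‖ < 1 → c z = α +
      Dα' ∘L Ring.inverse (1 + b0 z ∘L adjoint α) ∘L b0 z ∘L Dα := fun z hz =>
    s18_form_left α Dα Dα' hDα'2 hi (s18_inj' α hα Dα' hDα'2) (b0 z) (c z)
      (hu z hz).1 (hu z hz).2 (hcdef z hz)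
  have hcro := fun (z w : EuclideanSpace ℂ (Fin d)) (hz : ‖z‖ < 1) (hw : ‖w‖ < 1) =>
    s18_crofoot α Dα hDα hDα2 Dα' hDα' hDα'2 hi (b0 z) (b0 w)
        (c z) (c w) (hu z hz).1 (hu w hw).1 (hform z hz) (hform w hw)
  refine ⟨?_, fun z w hz hw => (hcro z w hz hw).1, fun z hz => (hcro z z hz hz).2.1⟩
  refine s18_transfer b0 c (fun z => Dα' ∘L Ring.inverse (1 + b0 z ∘L adjoint α)) ?_ hS0
  intro z w hz hw
  obtain ⟨h3, -, h4⟩ := hcro z w hz hw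
  rw [h3, h4, adjoint_comp, hDα'.isSelfAdjoint.adjoint_eq]
  simp only [comp_assoc]

end
end
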